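/- arXiv:2510.12975 — 2 statements merged into one kernel-verified Lean document; each statement's English description precedes it below -/
import Mathlib

section
/- One-dimensional tangent-direction bound: let x and ε be independent real random variables with x ~ N(0, τ²) and ε ~ N(0, 1), and let σ > 0. Then for every measurable function g : ℝ → ℝ, E[(ε − g(x + σε))²] ≥ τ²/(τ² + σ²). -/
open MeasureTheory ProbabilityTheory Real Filter
open scoped ENNReal NNReal Topology

noncomputable section

/-- **One-dimensional tangent-direction bound.**
If `x ~ N(0, τ²)` and `ε ~ N(0, 1)` are independent and `σ > 0`, then for every measurable
`g : ℝ → ℝ`, `E[(ε − g(x + σε))²] ≥ τ²/(τ² + σ²)`. -/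
theorem one_dim_tangent_direction_bound
    {τ σ : ℝ} (hτ : 0 < τ) (hσ : 0 < σ)
    {Ω : Type*} [MeasureSpace Ω] [IsProbabilityMeasure (ℙ : Measure Ω)]
    {x ε : Ω → ℝ} (hxm : Measurable x) (hεm : Measurable ε)
    (hx : Measure.map x ℙ = gaussianReal 0 (Real.toNNReal (τ ^ 2)))
    (hε : Measure.map ε ℙ = gaussianReal 0 1)
    (hindep : IndepFun x ε ℙ)
    (g : ℝ → ℝ) (hg : Measurable g) :
    ENNReal.ofReal (τ ^ 2 / (τ ^ 2 + σ ^ 2)) ≤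
      ∫⁻ ω, ENNReal.ofReal ((ε ω - g (x ω + σ * ε ω)) ^ 2) ∂ℙ := by
  have hs : 0 < τ ^ 2 + σ ^ 2 := by positivity
  set a : ℝ := τ ^ 2 / (τ ^ 2 + σ ^ 2) with ha
  set b : ℝ := -σ / (τ ^ 2 + σ ^ 2) with hb
  have hxG : HasGaussianLaw x ℙ := ⟨by rw [hx]; infer_instance⟩
  have hεG : HasGaussianLaw ε ℙ := ⟨by rw [hε]; infer_instance⟩
  have hx2 : MemLp x 2 ℙ := hxG.memLp_two
  have hε2 : MemLp ε 2 ℙ := hεG.memLp_two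
  have hxv : Var[x; ℙ] = τ ^ 2 := by
    have h := variance_map (μ := (ℙ : Measure Ω)) (X := id) (Y := x)
      aemeasurable_id hxm.aemeasurable
    rw [hx, variance_id_gaussianReal] at h
    simpa [Real.coe_toNNReal _ (sq_nonneg τ)] using h.symm
  have hεv : Var[ε; ℙ] = 1 := by
    have h := variance_map (μ := (ℙ : Measure Ω)) (X := id) (Y := ε)
      aemeasurable_id hεm.aemeasurable
    rw [hε, variance_id_gaussianReal] at h
    simpa using h.symm
  have hc : cov[x, ε; ℙ] = 0 := hindep.covariance_eq_zero hx2 hε2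
  have hc' : cov[ε, x; ℙ] = 0 := by rw [covariance_comm, hc]
  let Y : Ω → ℝ := x + σ • ε
  let Z : Ω → ℝ := a • ε + b • x
  have hY2 : MemLp Y 2 ℙ := hx2.add (hε2.const_smul σ)
  have hZ2 : MemLp Z 2 ℙ := (hε2.const_smul a).add (hx2.const_smul b)
  have hcov : cov[Z, Y; ℙ] = 0 := by
    change cov[a • ε + b • x, x + σ • ε; ℙ] = 0
    rw [covariance_add_left (hε2.const_smul a) (hx2.const_smul b) hY2,
      covariance_add_right (hε2.const_smul a) hx2 (hε2.const_smul σ),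
      covariance_add_right (hx2.const_smul b) hx2 (hε2.const_smul σ)]
    simp only [covariance_smul_left, covariance_smul_right, hc, hc',
      covariance_self hxm.aemeasurable, covariance_self hεm.aemeasurable, hxv, hεv]
    rw [ha, hb]; field_simp; ring
  have hvar : Var[Z; ℙ] = a := by
    change Var[a • ε + b • x; ℙ] = a
    rw [variance_add (hε2.const_smul a) (hx2.const_smul b), variance_smul, variance_smul,
      covariance_smul_left, covariance_smul_right, hc', hxv, hεv, ha, hb]
    field_simp; ring
  have hG : HasGaussianLaw (fun ω => (Z ω, Y ω)) ℙ := by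
    have h := hindep.hasGaussianLaw hxG hεG
    let F := ContinuousLinearMap.fst ℝ ℝ ℝ
    let S := ContinuousLinearMap.snd ℝ ℝ ℝ
    have h2 := h.map ((a • S + b • F).prod (F + σ • S))
    exact h2
  have hI : IndepFun Z Y ℙ := hG.indepFun_of_covariance_eq_zero hcov
  let W : Ω → ℝ := fun ω => ε ω - g (x ω + σ * ε ω)
  have hWm : Measurable W := by fun_prop
  change _ ≤ ∫⁻ ω, ENNReal.ofReal (W ω ^ 2) ∂ℙ
  by_cases hW : Integrable (fun ω => W ω ^ 2) ℙ
  swap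
  · have : ∫⁻ ω, ENNReal.ofReal (W ω ^ 2) ∂ℙ = ⊤ := by
      by_contra hne
      exact hW ((lintegral_ofReal_ne_top_iff_integrable
        (hWm.pow_const 2).aestronglyMeasurable (ae_of_all _ fun ω => sq_nonneg _)).1 hne)
    rw [this]; exact le_top
  have hW2 : MemLp W 2 ℙ := (memLp_two_iff_integrable_sq hWm.aestronglyMeasurable).2 hW
  let k : ℝ → ℝ := fun y => σ / (τ ^ 2 + σ ^ 2) * y - g y
  have hk : Measurable k := by fun_prop
  have hWeq : W = Z + k ∘ Y := by
    funext ω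
    simp only [W, Z, Y, k, Pi.add_apply, Pi.smul_apply, smul_eq_mul, Function.comp]
    rw [ha, hb]; field_simp; ring
  have hk2 : MemLp (k ∘ Y) 2 ℙ := by
    have h := hW2.sub hZ2
    rwa [hWeq, add_sub_cancel_left] at h
  have hI' : IndepFun Z (k ∘ Y) ℙ := hI.comp measurable_id hk
  have hV : Var[W; ℙ] = a + Var[k ∘ Y; ℙ] := by
    rw [hWeq, hI'.variance_add hZ2 hk2, hvar]
  rw [← ofReal_integral_eq_lintegral_ofReal hW (ae_of_all _ fun ω => sq_nonneg _)]
  apply ENNReal.ofReal_le_ofReal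
  have h1 := variance_le_expectation_sq (μ := (ℙ : Measure Ω)) hWm.aestronglyMeasurable
  have h2 := variance_nonneg (k ∘ Y) (ℙ : Measure Ω)
  have h3 : ∫ ω, (W ^ 2) ω ∂ℙ = ∫ ω, W ω ^ 2 ∂ℙ := rfl
  linarith
end
end

section
/- Expected FLIPD of a Gaussian equals the ambient dimension: let Σ be a positive-definite n×n real matrix, m ∈ ℝⁿ, σ > 0, and let p be the density of the Gaussian measure N(m, Σ) on ℝⁿ. Then ∫_{ℝⁿ} p(x)·(σ²·(Δlog p(x) + ‖∇log p(x)‖²) + n) dx = n. In particular, in the Gaussian linear model with covariance Σ = τ²P_V + σ²I_n for a d-dimensional subspace V with d ≤ n, the expected FLIPD satisfies E[FLIPD(X̃)] = n ≥ d, where FLIPD(y) := σ²·(Δlog p(y) + ‖∇log p(y)‖²) + n. -/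
open MeasureTheory ProbabilityTheory Real Filter
open scoped ENNReal NNReal Topology

noncomputable section

/-- Divergence of a vector field on `ℝⁿ` (trace of the Jacobian). -/
def vdiv {n : ℕ} (v : EuclideanSpace ℝ (Fin n) → EuclideanSpace ℝ (Fin n))
    (x : EuclideanSpace ℝ (Fin n)) : ℝ :=
  ∑ i, fderiv ℝ v x (EuclideanSpace.single i 1) i

/-- Laplacian of a scalar function on `ℝⁿ`: divergence of the gradient. -/
def lap {n : ℕ} (f : EuclideanSpace ℝ (Fin n) → ℝ) : EuclideanSpace ℝ (Fin n) → ℝ :=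
  vdiv (fun y => gradient f y)

/-- Lebesgue density of the multivariate Gaussian measure `N(m, S)` on `ℝⁿ`:
`p(x) = (2π)^{-n/2} det(S)^{-1/2} exp(−½⟨x − m, S⁻¹(x − m)⟩)`. -/
def gaussDensity {n : ℕ} (m : EuclideanSpace ℝ (Fin n)) (S : Matrix (Fin n) (Fin n) ℝ)
    (x : EuclideanSpace ℝ (Fin n)) : ℝ :=
  (2 * π) ^ (-(n : ℝ) / 2) * S.det ^ (-(1 : ℝ) / 2) *
    Real.exp (-(1 / 2) * ∑ i, (x i - m i) * (S⁻¹.mulVec (fun j => x j - m j)) i)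

/-- The FLIPD estimator at the true score of a density `p`:
`FLIPD(y) := σ²·(Δlog p(y) + ‖∇log p(y)‖²) + n`. -/
def flipd {n : ℕ} (σ : ℝ) (p : EuclideanSpace ℝ (Fin n) → ℝ)
    (y : EuclideanSpace ℝ (Fin n)) : ℝ :=
  σ ^ 2 * (lap (fun z => Real.log (p z)) y
    + ‖gradient (fun z => Real.log (p z)) y‖ ^ 2) + n

section Aux

open scoped Matrix

abbrev phi1 (x : ℝ) : ℝ := gaussianPDFReal 0 1 x

lemma phi1_eq (x : ℝ) : phi1 x = (2 * π) ^ (-(1:ℝ)/2) * Real.exp (-(1/2) * x ^ 2) := by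
  have : (2*π) ^ (-(1:ℝ)/2) = (√(2 * π))⁻¹ := by
    rw [Real.sqrt_eq_rpow, ← Real.rpow_neg (by positivity)]; norm_num
  simp only [phi1, gaussianPDFReal, this]
  simp
  left; ring

lemma phi1_int (k : ℕ) : Integrable (fun x : ℝ => phi1 x * x ^ k) := by
  have h := integrable_rpow_mul_exp_neg_mul_sq (b := 1/2) (by norm_num) (s := (k:ℝ))
    (by have : (0:ℝ) ≤ k := by positivity
        linarith)
  have h2 := h.const_mul ((2 * π) ^ (-(1:ℝ)/2))
  refine h2.congr (ae_of_all _ fun x => ?_)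
  simp only [phi1_eq, Real.rpow_natCast]
  ring

lemma phi1_m0 : ∫ x, phi1 x = 1 := integral_gaussianPDFReal_eq_one 0 one_ne_zero

lemma phi1_m1 : ∫ x, phi1 x * x = 0 := by
  have h := integral_gaussianReal_eq_integral_smul (μ := 0) (v := 1) (f := fun x : ℝ => x) one_ne_zero
  rw [integral_id_gaussianReal] at h
  simpa using h.symm

lemma phi1_m2 : ∫ x, phi1 x * x ^ 2 = 1 := by
  have h := integral_gaussianReal_eq_integral_smul (μ := 0) (v := 1) (f := fun x : ℝ => x ^ 2) one_ne_zero
  have h2 := variance_id_gaussianReal (μ := 0) (v := 1)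
  rw [variance_of_integral_eq_zero (by fun_prop) (by simp)] at h2
  simp only [id, smul_eq_mul] at h h2
  rw [← h]; simpa using h2

/-- standard Gaussian density on `Fin n → ℝ`. -/
def phin {n : ℕ} (z : Fin n → ℝ) : ℝ := ∏ i, phi1 (z i)

lemma phin_eq {n : ℕ} (z : Fin n → ℝ) :
    phin z = (2 * π) ^ (-(n:ℝ)/2) * Real.exp (-(1/2) * ∑ i, z i ^ 2) := by
  simp only [phin, phi1_eq]
  rw [Finset.prod_mul_distrib, ← Real.exp_sum, ← Finset.mul_sum, Finset.prod_const,
    ← Real.rpow_natCast, ← Real.rpow_mul (by positivity)]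
  simp
  ring_nf

lemma phin_mul {n : ℕ} (j k : Fin n) (z : Fin n → ℝ) :
    phin z * (z j * z k) =
      ∏ i, (phi1 (z i) * (z i) ^ ((if i = j then 1 else 0) + (if i = k then 1 else 0))) := by
  rw [Finset.prod_mul_distrib]
  simp only [pow_add, Finset.prod_mul_distrib, pow_ite, pow_one, pow_zero]
  simp [phin]

lemma phin_int {n : ℕ} : Integrable (fun z : Fin n → ℝ => phin z) := by
  refine Integrable.fintype_prod (f := fun _ x => phi1 x) fun i => ?_
  simpa using phi1_int 0

lemma phin_mul_int {n : ℕ} (j k : Fin n) : Integrable (fun z : Fin n → ℝ => phin z * (z j * z k)) := by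
  simp only [phin_mul]
  exact Integrable.fintype_prod (f := fun i x => phi1 x *
    x ^ ((if i = j then 1 else 0) + (if i = k then 1 else 0))) fun i => phi1_int _

lemma phin_m0 {n : ℕ} : ∫ z : Fin n → ℝ, phin z = 1 := by
  simp only [phin]
  rw [integral_fintype_prod_volume_eq_prod (f := fun _ x => phi1 x)]
  simp only [phi1_m0, Finset.prod_const_one]

lemma phin_m2 {n : ℕ} (j k : Fin n) :
    ∫ z : Fin n → ℝ, phin z * (z j * z k) = if j = k then 1 else 0 := by
  simp only [phin_mul]
  rw [integral_fintype_prod_volume_eq_prod (f := fun i x => phi1 x *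
    x ^ ((if i = j then 1 else 0) + (if i = k then 1 else 0)))]
  by_cases h : j = k
  · subst h
    rw [if_pos rfl]
    refine Finset.prod_eq_one fun i _ => ?_
    by_cases hi : i = j
    · simp only [hi, if_true]; exact phi1_m2
    · simp only [hi, if_false, add_zero, pow_zero, mul_one]; exact phi1_m0
  · rw [if_neg h]
    refine Finset.prod_eq_zero (Finset.mem_univ j) ?_
    simp only [if_true, h, if_false, add_zero, pow_one]; exact phi1_m1

lemma phin_quad {n : ℕ} (D : Matrix (Fin n) (Fin n) ℝ) (a b c : ℝ) :
    ∫ z : Fin n → ℝ, phin z * (a * (b + ∑ i, (D.mulVec z) i ^ 2) + c)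
      = a * (b + ∑ i, ∑ j, D i j ^ 2) + c := by
  have e : ∀ z : Fin n → ℝ, phin z * (a * (b + ∑ i, (D.mulVec z) i ^ 2) + c)
      = (a * b + c) * phin z + a * ∑ i, ∑ j, ∑ k, (D i j * D i k) * (phin z * (z j * z k)) := by
    intro z
    have : ∀ i, (D.mulVec z) i ^ 2 = ∑ j, ∑ k, (D i j * D i k) * (z j * z k) := by
      intro i
      simp only [Matrix.mulVec, dotProduct, sq, Finset.sum_mul_sum]
      refine Finset.sum_congr rfl fun j _ => Finset.sum_congr rfl fun k _ => by ring
    have h2 : ∑ i, ∑ j, ∑ k, (D i j * D i k) * (phin z * (z j * z k))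
        = phin z * ∑ i, (D.mulVec z) i ^ 2 := by
      simp only [this, Finset.mul_sum]
      refine Finset.sum_congr rfl fun i _ => Finset.sum_congr rfl fun j _ =>
        Finset.sum_congr rfl fun k _ => by ring
    rw [h2]; ring
  simp only [e]
  have i1 : ∀ i j k, Integrable (fun z : Fin n → ℝ => (D i j * D i k) * (phin z * (z j * z k))) :=
    fun i j k => (phin_mul_int j k).const_mul _
  have i2 : ∀ i j, Integrable (fun z : Fin n → ℝ => ∑ k, (D i j * D i k) * (phin z * (z j * z k))) :=
    fun i j => integrable_finsetSum _ fun k _ => i1 i j k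
  have i3 : ∀ i, Integrable (fun z : Fin n → ℝ => ∑ j, ∑ k, (D i j * D i k) * (phin z * (z j * z k))) :=
    fun i => integrable_finsetSum _ fun j _ => i2 i j
  rw [integral_add (phin_int.const_mul _) ((integrable_finsetSum _ fun i _ => i3 i).const_mul _),
    integral_const_mul, integral_const_mul, phin_m0, integral_finsetSum _ fun i _ => i3 i]
  simp only [integral_finsetSum _ fun j _ => i2 _ j, integral_finsetSum _ fun k _ => i1 _ _ k,
    integral_const_mul, phin_m2]
  simp
  simp only [← sq]
  ring

lemma cov_lin {n : ℕ} (C : Matrix (Fin n) (Fin n) ℝ) (hC : C.det ≠ 0)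
    (m : EuclideanSpace ℝ (Fin n)) (f : EuclideanSpace ℝ (Fin n) → ℝ) :
    ∫ x, f x = ∫ z : Fin n → ℝ, |C.det| * f (m + WithLp.toLp 2 (C.mulVec z)) := by
  rw [← integral_add_left_eq_self f m,
    ← (PiLp.volume_preserving_toLp (Fin n)).integral_comp
      (MeasurableEquiv.toLp 2 (Fin n → ℝ)).measurableEmbedding, integral_const_mul]
  have h := Real.map_matrix_volume_pi_eq_smul_volume_pi hC
  have hme : MeasurableEmbedding (Matrix.toLin' C) := by
    have : IsUnit C := (Matrix.isUnit_iff_isUnit_det C).2 (isUnit_iff_ne_zero.2 hC)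
    have hinj : Function.Injective (Matrix.toLin' C) := Matrix.mulVec_injective_of_isUnit this
    exact ((Matrix.toLin' C).continuous_of_finiteDimensional).measurableEmbedding hinj
  have h2 := hme.integral_map (μ := volume) (fun y => f (m + WithLp.toLp 2 y))
  rw [h, integral_smul_measure, ENNReal.toReal_ofReal (abs_nonneg _)] at h2
  simp only [Matrix.toLin'_apply] at h2
  rw [← h2, smul_eq_mul, ← mul_assoc, abs_inv, mul_inv_cancel₀ (abs_ne_zero.2 hC), one_mul]

lemma grad_log {n : ℕ} (S : Matrix (Fin n) (Fin n) ℝ) (hS : S.PosDef)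
    (m x : EuclideanSpace ℝ (Fin n)) :
    gradient (fun z => Real.log (gaussDensity m S z)) x
      = -(Matrix.toEuclideanCLM (𝕜 := ℝ) S⁻¹ (x - m)) := by
  set T := Matrix.toEuclideanCLM (n := Fin n) (𝕜 := ℝ) S⁻¹ with hT
  have hsym : ∀ u v, inner ℝ u (T v) = inner ℝ (T u) v := by
    intro u v
    have hA : (S⁻¹)ᵀ = S⁻¹ := by
      have := hS.1.inv
      simpa [Matrix.IsHermitian, Matrix.conjTranspose_eq_transpose_of_trivial] using this
    have e1 : inner ℝ u (T v) = (u.ofLp) ⬝ᵥ (S⁻¹.mulVec v.ofLp) := by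
      rw [hT, Matrix.inner_toEuclideanCLM]
    have e2 : inner ℝ (T u) v = (v.ofLp) ⬝ᵥ (S⁻¹.mulVec u.ofLp) := by
      rw [real_inner_comm, hT, Matrix.inner_toEuclideanCLM]
    rw [e1, e2, Matrix.dotProduct_mulVec, ← Matrix.mulVec_transpose, hA, dotProduct_comm]
  have hlog : (fun z => Real.log (gaussDensity m S z)) = fun z =>
      Real.log ((2 * π) ^ (-(n : ℝ) / 2) * S.det ^ (-(1 : ℝ) / 2))
        + (-(1/2)) * inner ℝ (z - m) (T (z - m)) := by
    ext z
    have := hS.det_pos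
    rw [gaussDensity, Real.log_mul (by positivity) (by positivity), Real.log_exp]
    congr 2
    rw [hT, Matrix.inner_toEuclideanCLM]
    simp [dotProduct]
    rfl
  rw [hlog]
  apply HasGradientAt.gradient
  rw [hasGradientAt_iff_hasFDerivAt]
  have h1 : HasFDerivAt (fun z => z - m) (ContinuousLinearMap.id ℝ (EuclideanSpace ℝ (Fin n))) x :=
    (hasFDerivAt_id x).sub_const m
  have h2 := T.hasFDerivAt.comp x h1
  have h3 := ((h1.inner ℝ h2).const_mul (-(1/2))).const_add
    (Real.log ((2 * π) ^ (-(n : ℝ) / 2) * S.det ^ (-(1 : ℝ) / 2)))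
  refine h3.congr_fderiv ?_
  ext v
  simp [hsym]
  rw [real_inner_comm v]
  rw [inner_sub_right, real_inner_comm (T x) v, real_inner_comm (T m) v]
  ring

lemma lap_log {n : ℕ} (S : Matrix (Fin n) (Fin n) ℝ) (hS : S.PosDef)
    (m x : EuclideanSpace ℝ (Fin n)) :
    lap (fun z => Real.log (gaussDensity m S z)) x = - S⁻¹.trace := by
  unfold lap
  simp only [grad_log S hS m]
  unfold vdiv
  have h1 : HasFDerivAt (fun z => z - m) (ContinuousLinearMap.id ℝ (EuclideanSpace ℝ (Fin n))) x :=
    (hasFDerivAt_id x).sub_const m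
  have h2 := ((Matrix.toEuclideanCLM (n := Fin n) (𝕜 := ℝ) S⁻¹).hasFDerivAt.comp x h1).neg
  have h3 : fderiv ℝ (fun y => -(Matrix.toEuclideanCLM (n := Fin n) (𝕜 := ℝ) S⁻¹) (y - m)) x = _ :=
    h2.fderiv
  rw [h3]
  simp [Matrix.trace]

theorem main_eq
    {n : ℕ} (S : Matrix (Fin n) (Fin n) ℝ) (hS : S.PosDef)
    (m : EuclideanSpace ℝ (Fin n)) (σ : ℝ) :
    (∫ x, gaussDensity m S x * flipd σ (gaussDensity m S) x = (n : ℝ)) := by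
  obtain ⟨C, hCS⟩ : ∃ C : Matrix (Fin n) (Fin n) ℝ, S = C * Cᵀ := by
    open scoped MatrixOrder Matrix.Norms.L2Operator in
    obtain ⟨B, hB⟩ := CStarAlgebra.nonneg_iff_eq_star_mul_self.mp hS.posSemidef.nonneg
    refine ⟨Bᵀ, ?_⟩
    rw [hB, Matrix.star_eq_conjTranspose, Matrix.conjTranspose_eq_transpose_of_trivial,
      Matrix.transpose_transpose]
  have hdet : S.det = C.det ^ 2 := by rw [hCS, Matrix.det_mul, Matrix.det_transpose, sq]
  have hSpos := hS.det_pos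
  have hC : C.det ≠ 0 := by
    intro h; rw [hdet, h] at hSpos; simp at hSpos
  have hu : IsUnit C.det := isUnit_iff_ne_zero.2 hC
  have hA : S⁻¹ = (C⁻¹)ᵀ * C⁻¹ := by
    rw [hCS, Matrix.mul_inv_rev, Matrix.transpose_nonsing_inv]
  have hAC : S⁻¹ * C = (C⁻¹)ᵀ := by
    rw [hA, Matrix.mul_assoc, Matrix.nonsing_inv_mul _ hu, Matrix.mul_one]
  have hCAC : Cᵀ * (C⁻¹)ᵀ = 1 := by
    rw [← Matrix.transpose_mul, Matrix.nonsing_inv_mul _ hu, Matrix.transpose_one]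
  rw [cov_lin C hC m]
  have key : ∀ z : Fin n → ℝ, |C.det| * (gaussDensity m S (m + WithLp.toLp 2 (C.mulVec z))
      * flipd σ (gaussDensity m S) (m + WithLp.toLp 2 (C.mulVec z)))
      = phin z * (σ ^ 2 * (- S⁻¹.trace + ∑ i, ((C⁻¹)ᵀ.mulVec z) i ^ 2) + n) := by
    intro z
    have hd : |C.det| * S.det ^ (-(1:ℝ)/2) = 1 := by
      rw [hdet, ← sq_abs, ← Real.rpow_natCast, ← Real.rpow_mul (abs_nonneg _)]
      norm_num
      rw [Real.rpow_neg_one, mul_inv_cancel₀ (abs_ne_zero.2 hC)]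
    have hp : |C.det| * gaussDensity m S (m + WithLp.toLp 2 (C.mulVec z)) = phin z := by
      rw [phin_eq, gaussDensity]
      have : ∑ i, ((m + WithLp.toLp 2 (C.mulVec z)) i - m i) *
          (S⁻¹.mulVec (fun j => (m + WithLp.toLp 2 (C.mulVec z)) j - m j)) i = ∑ i, z i ^ 2 := by
        have e : (fun j => (m + WithLp.toLp 2 (C.mulVec z)) j - m j) = C.mulVec z := by
          ext j; simp
        rw [e, Matrix.mulVec_mulVec, hAC]
        have : C.mulVec z ⬝ᵥ (C⁻¹)ᵀ.mulVec z = z ⬝ᵥ z := by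
          rw [dotProduct_comm, Matrix.dotProduct_mulVec, ← Matrix.mulVec_transpose,
            Matrix.mulVec_mulVec, hCAC, Matrix.one_mulVec]
        simpa [dotProduct, sq] using this
      rw [this]
      linear_combination ((2 * π) ^ (-(n:ℝ)/2) * Real.exp (-(1/2) * ∑ i, z i ^ 2)) * hd
    have hf : flipd σ (gaussDensity m S) (m + WithLp.toLp 2 (C.mulVec z))
        = σ ^ 2 * (- S⁻¹.trace + ∑ i, ((C⁻¹)ᵀ.mulVec z) i ^ 2) + n := by
      rw [flipd, lap_log S hS, grad_log S hS, norm_neg, EuclideanSpace.norm_sq_eq]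
      simp [Matrix.mulVec_mulVec, hAC]
    rw [← mul_assoc, hp, hf]
  simp only [key]
  rw [phin_quad]
  have : S⁻¹.trace = ∑ i, ∑ j, (C⁻¹)ᵀ i j ^ 2 := by
    rw [hA]; simp [Matrix.trace, Matrix.mul_apply, sq]
  rw [this]; ring

end Aux

/-- **Expected FLIPD of a Gaussian equals the ambient dimension.**
For `p` the density of `N(m, S)` with `S` positive definite and any `σ > 0`,
`∫ p(x)·FLIPD(x) dx = n`; in particular (taking `S = τ²P_V + σ²Iₙ` for a `d`-dimensional
subspace `V` with `d ≤ n`, as in the Gaussian linear model), `E[FLIPD(X̃)] = n ≥ d`. -/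
theorem expected_flipd_gaussian
    {n : ℕ} (S : Matrix (Fin n) (Fin n) ℝ) (hS : S.PosDef)
    (m : EuclideanSpace ℝ (Fin n)) {σ : ℝ} (hσ : 0 < σ) :
    (∫ x, gaussDensity m S x * flipd σ (gaussDensity m S) x = (n : ℝ)) ∧
    (∀ d : ℕ, d ≤ n → (d : ℝ) ≤ ∫ x, gaussDensity m S x * flipd σ (gaussDensity m S) x) := by
  have h := main_eq S hS m σ
  refine ⟨h, fun d hd => ?_⟩
  rw [h]
  exact_mod_cast hd
end
end
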